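/- arXiv:1607.07569 — 11 statements merged into one kernel-verified Lean document; each statement's English description precedes it below -/
import Mathlib

section
/- Let M > 0. There exists a function y defined on (0, 2M], differentiable on (0, 2M), such that: (i) for all r ∈ (0, 2M), y'(r) ≠ 3y(r)/r + r^{1/2}(r − 3M)/(2M − r)^{1/2}; (ii) y'(r) < 0 for all r ∈ (0, 2M); (iii) y(2M) = 0; and (iv) y(r) → +∞ as r → 0⁺. -/
open Real Filter Set

/-- The derivative of `r^(3/2) (2M - r)^(1/2) + 10 M² (2M - r) / r`. -/
theorem hasDerivAt_sqrt_profile {M r : ℝ} (h0 : 0 < r) (h2 : r < 2 * M) :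
    HasDerivAt (fun r : ℝ => r * √r * √(2 * M - r) + 10 * M ^ 2 * (2 * M * r⁻¹ - 1))
      (√r * (3 * M - 2 * r) / √(2 * M - r) - 20 * M ^ 3 / r ^ 2) r := by
  have hs : 0 < 2 * M - r := by linarith
  have ha := Real.sqrt_pos.2 h0
  have hb := Real.sqrt_pos.2 hs
  have hroot := ((hasDerivAt_id r).const_sub (2 * M)).sqrt hs.ne'
  have hsum := (((hasDerivAt_id r).mul (Real.hasDerivAt_sqrt h0.ne')).mul hroot).add
    ((((hasDerivAt_inv h0.ne').const_mul (2 * M)).sub_const 1).const_mul (10 * M ^ 2))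
  refine hsum.congr_deriv ?_
  have ea : √r ^ 2 = r := Real.sq_sqrt h0.le
  have eb : √(2 * M - r) ^ 2 = 2 * M - r := Real.sq_sqrt hs.le
  simp only [id, Pi.mul_apply]
  generalize √r = a at *
  generalize √(2 * M - r) = b at *
  obtain rfl : M = (b ^ 2 + r) / 2 := by linarith
  subst ea
  field_simp
  ring

/-- Proposition 1: existence of a strictly decreasing function `y` on `(0, 2M]`
whose derivative never equals `3y/r + √r (r-3M)/√(2M-r)`, with `y(2M) = 0` and
`y(r) → ∞` as `r → 0⁺`. -/
theorem stmt0 (M : ℝ) (hM : 0 < M) :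
    ∃ y : ℝ → ℝ,
      (∀ r ∈ Set.Ioo (0:ℝ) (2*M), DifferentiableAt ℝ y r) ∧
      (∀ r ∈ Set.Ioo (0:ℝ) (2*M),
        deriv y r ≠ 3 * y r / r + Real.sqrt r * (r - 3*M) / Real.sqrt (2*M - r)) ∧
      (∀ r ∈ Set.Ioo (0:ℝ) (2*M), deriv y r < 0) ∧
      y (2*M) = 0 ∧
      Tendsto y (nhdsWithin 0 (Set.Ioi 0)) atTop := by
  refine ⟨fun r => r * √r * √(2 * M - r) + 10 * M ^ 2 * (2 * M * r⁻¹ - 1),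
    fun r hr => (hasDerivAt_sqrt_profile hr.1 hr.2).differentiableAt, ?_, ?_, ?_, ?_⟩
  · rintro r ⟨h0, h2⟩
    rw [(hasDerivAt_sqrt_profile h0 h2).deriv]
    have hs : 0 < 2 * M - r := by linarith
    have hb := Real.sqrt_pos.2 hs
    have eb : √(2 * M - r) ^ 2 = 2 * M - r := Real.sq_sqrt hs.le
    refine ne_of_lt (sub_neg.1 ?_)
    have key : √r * (3 * M - 2 * r) / √(2 * M - r) - 20 * M ^ 3 / r ^ 2 -
        (3 * (r * √r * √(2 * M - r) + 10 * M ^ 2 * (2 * M * r⁻¹ - 1)) / r +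
          √r * (r - 3 * M) / √(2 * M - r)) =
        -(20 * M ^ 3 / r ^ 2 + 30 * M ^ 2 * (2 * M - r) / r ^ 2) := by
      generalize √r = a at *
      generalize √(2 * M - r) = b at *
      obtain rfl : M = (b ^ 2 + r) / 2 := by linarith
      field_simp
      ring
    rw [key]
    exact neg_neg_of_pos (by positivity)
  · rintro r ⟨h0, h2⟩
    rw [(hasDerivAt_sqrt_profile h0 h2).deriv]
    have hs : 0 < 2 * M - r := by linarith
    have hb := Real.sqrt_pos.2 hs
    have hp : 0 < 20 * M ^ 3 / r ^ 2 := by positivity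
    rcases le_total (3 * M) (2 * r) with h | h
    · have : √r * (3 * M - 2 * r) / √(2 * M - r) ≤ 0 :=
        div_nonpos_of_nonpos_of_nonneg
          (mul_nonpos_of_nonneg_of_nonpos (Real.sqrt_nonneg r) (by linarith)) hb.le
      linarith
    · have hab : √r ≤ 2 * √(2 * M - r) := by
        refine Real.sqrt_le_iff.2 ⟨by positivity, ?_⟩
        rw [mul_pow, Real.sq_sqrt hs.le]
        linarith
      have hleft : √r * (3 * M - 2 * r) / √(2 * M - r) ≤ 6 * M := by
        rw [div_le_iff₀ hb]
        calc √r * (3 * M - 2 * r) ≤ 2 * √(2 * M - r) * (3 * M) := by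
              gcongr
              linarith
          _ = 6 * M * √(2 * M - r) := by ring
      have hright : 6 * M < 20 * M ^ 3 / r ^ 2 := by
        rw [lt_div_iff₀ (by positivity)]
        have hr2 : r ^ 2 ≤ (3 / 2 * M) ^ 2 := by
          gcongr
          linarith
        nlinarith [pow_pos hM 3]
      linarith
  · have : 2 * M * (2 * M)⁻¹ = 1 := mul_inv_cancel₀ (by positivity)
    simp [this, -mul_inv_rev]
  · have hlim : Tendsto (fun r : ℝ => 10 * M ^ 2 * (2 * M * r⁻¹ - 1))
        (nhdsWithin 0 (Set.Ioi 0)) atTop :=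
      (tendsto_atTop_add_const_right _ (-1)
        (tendsto_inv_nhdsGT_zero.const_mul_atTop (by positivity : 0 < 2 * M))).const_mul_atTop
        (by positivity)
    refine tendsto_atTop_mono' _ ?_ hlim
    filter_upwards [self_mem_nhdsWithin] with r hr
    have h0 : 0 < r := hr
    exact le_add_of_nonneg_left (by positivity)
end

section
/- Let M > 0 and let A ∈ ℝ be arbitrary. There exists a function y defined on (0, 2M], differentiable on (0, 2M), such that: (i) for all r ∈ (0, 2M), y'(r) ≠ 3y(r)/r + r^{1/2}(r − 3M)/(2M − r)^{1/2}; (ii) y'(r) < 0 for all r ∈ (0, 2M); (iii) y(2M) = A; and (iv) y(r) → +∞ as r → 0⁺. -/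
open Real Filter Set

/-- If `h` has endpoint value `A`, is nonincreasing and satisfies `h' ≤ 3 h / r`, then adding the
barrier `6 M √(2M) √(2M - r) + 1/r - 1/(2M)` to it gives a solution of the problem. -/
lemma exists_of_homogeneous_subsolution {M A : ℝ} (hM : 0 < M) (h h' : ℝ → ℝ)
    (hd : ∀ r, HasDerivAt h (h' r) r) (hA : h (2 * M) = A)
    (hneg : ∀ r ∈ Set.Ioo (0 : ℝ) (2 * M), h' r ≤ 0)
    (hsub : ∀ r ∈ Set.Ioo (0 : ℝ) (2 * M), h' r ≤ 3 * h r / r) :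
    ∃ y : ℝ → ℝ,
      (∀ r ∈ Set.Ioo (0:ℝ) (2*M), DifferentiableAt ℝ y r) ∧
      (∀ r ∈ Set.Ioo (0:ℝ) (2*M),
        deriv y r ≠ 3 * y r / r + Real.sqrt r * (r - 3*M) / Real.sqrt (2*M - r)) ∧
      (∀ r ∈ Set.Ioo (0:ℝ) (2*M), deriv y r < 0) ∧
      y (2*M) = A ∧
      Tendsto y (nhdsWithin 0 (Set.Ioi 0)) atTop := by
  set K : ℝ := 3 * M * √(2 * M) with hK
  have hKpos : 0 < K := by positivity
  have key : ∀ r ∈ Set.Ioo (0 : ℝ) (2 * M),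
      HasDerivAt (fun r => r⁻¹ + (2 * K * √(2 * M - r) - (2 * M)⁻¹ + h r))
        (-(r ^ 2)⁻¹ + (-(K / √(2 * M - r)) + h' r)) r := by
    intro r hr
    have hpos : 0 < 2 * M - r := by linarith [hr.2]
    have hs := (((hasDerivAt_id r).const_sub (2 * M)).sqrt hpos.ne').const_mul (2 * K)
    refine (hasDerivAt_inv hr.1.ne').add
      (((hs.sub_const (2 * M)⁻¹).congr_deriv ?_).add (hd r))
    have : √(2 * M - r) ≠ 0 := (Real.sqrt_pos.2 hpos).ne'
    simp only [id]
    field_simp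
  refine ⟨_, fun r hr => (key r hr).differentiableAt, ?_, ?_, ?_, ?_⟩
  · intro r hr
    rw [(key r hr).deriv]
    apply ne_of_lt
    have hr0 := hr.1
    have hpos : 0 < √(2 * M - r) := Real.sqrt_pos.2 (by linarith [hr.2])
    have hF : -(K / √(2 * M - r)) ≤ √r * (r - 3 * M) / √(2 * M - r) := by
      rw [← neg_div]
      gcongr
      have h1 : √r ≤ √(2 * M) := Real.sqrt_le_sqrt hr.2.le
      have h2 := Real.sqrt_nonneg r
      nlinarith [mul_nonneg h2 hr0.le, mul_le_mul_of_nonneg_left h1 hM.le]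
    have hinv : (2 * M)⁻¹ ≤ r⁻¹ := by
      gcongr
      exact hr.2.le
    have hw : 0 ≤ 3 * (r⁻¹ + (2 * K * √(2 * M - r) - (2 * M)⁻¹)) / r := by
      have : 0 ≤ 2 * K * √(2 * M - r) := by positivity
      apply div_nonneg _ hr0.le
      linarith
    have hsplit : 3 * (r⁻¹ + (2 * K * √(2 * M - r) - (2 * M)⁻¹ + h r)) / r =
        3 * (r⁻¹ + (2 * K * √(2 * M - r) - (2 * M)⁻¹)) / r + 3 * h r / r := by ring
    have hsq : 0 < (r ^ 2)⁻¹ := by positivity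
    have := hsub r hr
    linarith
  · intro r hr
    rw [(key r hr).deriv]
    have hr0 := hr.1
    have hsq : 0 < (r ^ 2)⁻¹ := by positivity
    have : 0 ≤ K / √(2 * M - r) := by positivity
    linarith [hneg r hr]
  · simp [hA]
  · have hcont : Continuous h :=
      continuous_iff_continuousAt.2 fun r => (hd r).continuousAt
    have hc : Continuous fun r => 2 * K * √(2 * M - r) - (2 * M)⁻¹ + h r := by fun_prop
    exact tendsto_inv_nhdsGT_zero.atTop_add ((hc.tendsto 0).mono_left nhdsWithin_le_nhds)

/-- Generalized Proposition 1: same as Proposition 1 but with endpoint value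
`y(2M) = A` for an arbitrary real `A`. -/
theorem stmt1 (M : ℝ) (hM : 0 < M) (A : ℝ) :
    ∃ y : ℝ → ℝ,
      (∀ r ∈ Set.Ioo (0:ℝ) (2*M), DifferentiableAt ℝ y r) ∧
      (∀ r ∈ Set.Ioo (0:ℝ) (2*M),
        deriv y r ≠ 3 * y r / r + Real.sqrt r * (r - 3*M) / Real.sqrt (2*M - r)) ∧
      (∀ r ∈ Set.Ioo (0:ℝ) (2*M), deriv y r < 0) ∧
      y (2*M) = A ∧
      Tendsto y (nhdsWithin 0 (Set.Ioi 0)) atTop := by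
  rcases le_total 0 A with hA | hA
  · refine exists_of_homogeneous_subsolution hM (fun _ => A) (fun _ => 0)
      (fun r => hasDerivAt_const r A) rfl (fun _ _ => le_rfl) fun r hr => ?_
    have := hr.1
    positivity
  · refine exists_of_homogeneous_subsolution hM (fun r => A / (2 * M) ^ 3 * r ^ 3)
      (fun r => A / (2 * M) ^ 3 * (3 * r ^ 2)) (fun r => ?_) ?_ (fun r _ => ?_) fun r hr => ?_
    · simpa using (hasDerivAt_pow 3 r).const_mul (A / (2 * M) ^ 3)
    · field_simp
    · exact mul_nonpos_of_nonpos_of_nonneg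
        (div_nonpos_of_nonpos_of_nonneg hA (by positivity)) (by positivity)
    · have := hr.1.ne'
      apply le_of_eq
      field_simp
end

section
/- Let M > 0, p > 1, and C > 0, and define y(r) := r^{3/2}(2M − r)^{1/2} + (C/(p+2))(r^{1−p} − r³/(2M)^{p+2}) on (0, 2M]. Then y(2M) = 0, and for all r ∈ (0, 2M), y is differentiable at r with y'(r) − 3y(r)/r = r^{1/2}(r − 3M)/(2M − r)^{1/2} − C r^{−p}. In particular y'(r) ≠ 3y(r)/r + r^{1/2}(r − 3M)/(2M − r)^{1/2} for all r ∈ (0, 2M). -/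
open Real Filter Set

/-- The explicit function `y` built with `h(r) = C r^{-p}` satisfies `y(2M) = 0` and the
linear ODE `y' - 3y/r = √r (r - 3M)/√(2M-r) - C r^{-p}`; in particular
`y' ≠ 3y/r + √r (r - 3M)/√(2M-r)`. -/
theorem stmt2 (M p C : ℝ) (hM : 0 < M) (hp : 1 < p) (hC : 0 < C)
    (y : ℝ → ℝ)
    (hy : ∀ r, y r = r ^ ((3:ℝ)/2) * Real.sqrt (2*M - r)
        + (C/(p+2)) * (r ^ (1-p) - r^3 / (2*M) ^ (p+2))) :
    y (2*M) = 0 ∧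
    ∀ r ∈ Set.Ioo (0:ℝ) (2*M),
      DifferentiableAt ℝ y r ∧
      deriv y r - 3 * y r / r
        = Real.sqrt r * (r - 3*M) / Real.sqrt (2*M - r) - C * r ^ (-p) ∧
      deriv y r ≠ 3 * y r / r + Real.sqrt r * (r - 3*M) / Real.sqrt (2*M - r) := by
  have hp2 : p + 2 ≠ 0 := by linarith
  refine ⟨?_, fun r hr => ?_⟩
  · have h2M : 0 < 2 * M := by linarith
    have h : (2 * M) ^ (1 - p) = (2 * M) ^ 3 / (2 * M) ^ (p + 2) := by
      rw [← rpow_natCast, ← rpow_sub h2M]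
      congr 1
      push_cast
      ring
    rw [hy, ← h]
    simp
  · obtain ⟨hr0, hr2⟩ := hr
    have hs : 0 < 2 * M - r := by linarith
    have hderiv : HasDerivAt y
        (((3 : ℝ) / 2 * r ^ ((3 : ℝ) / 2 - 1)) * √(2 * M - r)
          + r ^ ((3 : ℝ) / 2) * (-1 / (2 * √(2 * M - r)))
          + C / (p + 2) * ((1 - p) * r ^ (1 - p - 1) - 3 * r ^ 2 / (2 * M) ^ (p + 2))) r := by
      rw [funext hy]
      have hpow := hasDerivAt_rpow_const (x := r) (p := (3 : ℝ) / 2) (Or.inl hr0.ne')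
      have hsqrt := ((hasDerivAt_id r).const_sub (2 * M)).sqrt hs.ne'
      have hpow' := hasDerivAt_rpow_const (x := r) (p := 1 - p) (Or.inl hr0.ne')
      have hcube := (hasDerivAt_pow 3 r).div_const ((2 * M) ^ (p + 2))
      exact (hpow.mul hsqrt).add ((hpow'.sub hcube).const_mul (C / (p + 2)))
    have h32 : r ^ ((3 : ℝ) / 2) = r * √r := by
      rw [sqrt_eq_rpow, ← rpow_one_add' hr0.le (by norm_num)]
      norm_num
    have h12 : r ^ ((3 : ℝ) / 2 - 1) = √r := by
      rw [sqrt_eq_rpow]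
      norm_num
    have h1p : r ^ (1 - p) = r * r ^ (-p) := by
      rw [sub_eq_add_neg, rpow_add hr0, rpow_one]
    have hp' : r ^ (1 - p - 1) = r ^ (-p) := by
      congr 1
      ring
    have hode : deriv y r - 3 * y r / r
        = √r * (r - 3 * M) / √(2 * M - r) - C * r ^ (-p) := by
      rw [hderiv.deriv, hy, h32, h12, h1p, hp']
      have hs0 : √(2 * M - r) ≠ 0 := (sqrt_pos.2 hs).ne'
      have hM0 : (2 * M) ^ (p + 2) ≠ 0 := (rpow_pos_of_pos (by linarith) _).ne'
      have hsq : √(2 * M - r) ^ 2 = 2 * M - r := sq_sqrt hs.le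
      generalize (2 * M) ^ (p + 2) = A at *
      generalize √(2 * M - r) = s at *
      obtain rfl : r = 2 * M - s ^ 2 := by linarith
      field_simp
      ring
    refine ⟨hderiv.differentiableAt, hode, fun h => ?_⟩
    have hpos : 0 < C * r ^ (-p) := mul_pos hC (rpow_pos_of_pos hr0 _)
    linarith
end

section
/- Let M > 0, p > 1, and C ≥ ((p+2)/(p−1))·(2M)^p·√(6√3 − 9)·M. Define y(r) := r^{3/2}(2M − r)^{1/2} + (C/(p+2))(r^{1−p} − r³/(2M)^{p+2}) on (0, 2M]. Then y'(r) < 0 for all r ∈ (0, 2M). -/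
open Real Filter Set

theorem sqrt_mul_three_sub_le {M r : ℝ} (hM : 0 < M) (h0 : 0 < r) (h2 : r < 2 * M) :
    √r * (3 * M - 2 * r) ≤ √(6 * √3 - 9) * M * √(2 * M - r) := by
  rcases le_total (3 * M - 2 * r) 0 with h | h
  · exact (mul_nonpos_of_nonneg_of_nonpos (sqrt_nonneg r) h).trans (by positivity)
  have hs : √3 ^ 2 = 3 := sq_sqrt (by norm_num)
  have hs' : 3 / 2 ≤ √3 := le_sqrt_of_sq_le (by norm_num)
  refine (pow_le_pow_iff_left₀ (by positivity) (by positivity) two_ne_zero).1 ?_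
  rw [mul_pow, mul_pow, mul_pow, sq_sqrt h0.le, sq_sqrt (by linarith : 0 ≤ 6 * √3 - 9),
    sq_sqrt (by linarith : 0 ≤ 2 * M - r)]
  have hb : 0 ≤ √3 * M - r := by nlinarith
  have hfac : (6 * √3 - 9) * M ^ 2 * (2 * M - r) - r * (3 * M - 2 * r) ^ 2
      = 4 * (r - (3 - √3) / 2 * M) ^ 2 * (√3 * M - r) := by
    generalize √3 = s at hs
    linear_combination (-(s * M ^ 3) + 6 * M ^ 3 - 3 * M ^ 2 * r) * hs
  have : 0 ≤ 4 * (r - (3 - √3) / 2 * M) ^ 2 * (√3 * M - r) := by positivity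
  linarith

theorem hasDerivAt_rpow_three_halves_mul_sqrt {a r : ℝ} (h0 : 0 < r) (h2 : r < a) :
    HasDerivAt (fun x : ℝ => x ^ ((3 : ℝ) / 2) * √(a - x))
      (√r * (3 / 2 * a - 2 * r) / √(a - r)) r := by
  have hpos : 0 < a - r := by linarith
  have h1 := hasDerivAt_rpow_const (p := (3 : ℝ) / 2) (Or.inl h0.ne')
  have h3 := ((hasDerivAt_id r).const_sub a).sqrt hpos.ne'
  refine (h1.mul h3).congr_deriv ?_
  have e1 : r ^ ((3 : ℝ) / 2 - 1) = √r := by rw [sqrt_eq_rpow]; norm_num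
  have e2 : r ^ ((3 : ℝ) / 2) = r * √r := by
    rw [sqrt_eq_rpow, ← rpow_one_add' h0.le (by norm_num)]; norm_num
  have hq : √(a - r) ^ 2 = a - r := sq_sqrt hpos.le
  have hq0 : √(a - r) ≠ 0 := (sqrt_pos.2 hpos).ne'
  simp only [id, e1, e2]
  field_simp
  rw [hq]
  ring

/-- For `C` large enough, namely `C ≥ ((p+2)/(p-1))(2M)^p √(6√3-9) M`, the explicit
function `y` of Proposition 1 is strictly decreasing on `(0, 2M)`. -/
theorem stmt4 (M p C : ℝ) (hM : 0 < M) (hp : 1 < p)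
    (hC : ((p+2)/(p-1)) * (2*M) ^ p * (Real.sqrt (6 * Real.sqrt 3 - 9) * M) ≤ C)
    (y : ℝ → ℝ)
    (hy : ∀ r, y r = r ^ ((3:ℝ)/2) * Real.sqrt (2*M - r)
        + (C/(p+2)) * (r ^ (1-p) - r^3 / (2*M) ^ (p+2))) :
    ∀ r ∈ Set.Ioo (0:ℝ) (2*M), deriv y r < 0 := by
  rintro r ⟨h0, h2⟩
  have hp1 : 0 < p - 1 := by linarith
  have hp2 : 0 < p + 2 := by linarith
  have hK : 0 < √(6 * √3 - 9) * M := by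
    have : 3 / 2 < √3 := lt_sqrt_of_sq_lt (by norm_num)
    exact mul_pos (sqrt_pos.2 (by linarith)) hM
  have hA : 0 < (2 * M) ^ p := by positivity
  have hC0 : 0 < C := lt_of_lt_of_le (by positivity) hC
  have hder : HasDerivAt y (√r * (3 / 2 * (2 * M) - 2 * r) / √(2 * M - r)
      + C / (p + 2) * ((1 - p) * r ^ (1 - p - 1) - (3 : ℕ) * r ^ 2 / (2 * M) ^ (p + 2))) r := by
    rw [funext hy]
    exact (hasDerivAt_rpow_three_halves_mul_sqrt h0 h2).add
      (((hasDerivAt_rpow_const (Or.inl h0.ne')).sub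
        ((hasDerivAt_pow 3 r).div_const _)).const_mul _)
  rw [hder.deriv]
  have hg : √r * (3 / 2 * (2 * M) - 2 * r) / √(2 * M - r) ≤ √(6 * √3 - 9) * M := by
    rw [div_le_iff₀ (sqrt_pos.2 (by linarith)), show 3 / 2 * (2 * M) = 3 * M by ring]
    exact sqrt_mul_three_sub_le hM h0 h2
  have hr : ((2 * M) ^ p)⁻¹ < r ^ (1 - p - 1) := by
    rw [← rpow_neg (by positivity), show 1 - p - 1 = -p by ring]
    exact rpow_lt_rpow_of_neg h0 h2 (by linarith)
  have hKC : √(6 * √3 - 9) * M ≤ C / (p + 2) * ((p - 1) * ((2 * M) ^ p)⁻¹) := by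
    calc √(6 * √3 - 9) * M
        = (p + 2) / (p - 1) * (2 * M) ^ p * (√(6 * √3 - 9) * M) / (p + 2)
          * ((p - 1) * ((2 * M) ^ p)⁻¹) := by field_simp
      _ ≤ _ := by gcongr
  have hlt : C / (p + 2) * ((p - 1) * ((2 * M) ^ p)⁻¹)
      < C / (p + 2) * ((p - 1) * r ^ (1 - p - 1)) := by gcongr
  have hcube : 0 ≤ C / (p + 2) * ((3 : ℕ) * r ^ 2 / (2 * M) ^ (p + 2)) := by positivity
  linarith
end

section
/- Let M > 0 and H ≤ 0, and define k̃(H,r) := −H r³ + r^{3/2}(2M − r)^{1/2} for r ∈ [0, 2M]. Then there exists a unique R_H ∈ (0, 2M) such that r ↦ k̃(H,r) is strictly increasing on [0, R_H] and strictly decreasing on [R_H, 2M]. Moreover R_H ∈ [3M/2, 2M) (with R_H = 3M/2 exactly when H = 0), and the maximum value C_H := k̃(H, R_H) satisfies C_H > 0 and C_H > k̃(H, 2M) = −8M³H. -/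
open Real Filter Set

lemma rpow_three_halves_mul_sqrt {r : ℝ} (hr : 0 ≤ r) (a : ℝ) :
    r ^ ((3:ℝ)/2) * √(a - r) = √(r^3 * (a - r)) := by
  rw [Real.sqrt_mul (by positivity), Real.sqrt_eq_rpow (r^3), ← Real.rpow_natCast r 3,
    ← Real.rpow_mul hr]
  norm_num

lemma hasDerivAt_cube_mul_sub (M x : ℝ) :
    HasDerivAt (fun r : ℝ => r^3 * (2*M - r)) (2 * x^2 * (3*M - 2*x)) x := by
  refine ((hasDerivAt_pow 3 x).mul ((hasDerivAt_id x).const_sub (2*M))).congr_deriv ?_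
  simp only [id]
  push_cast
  ring

/-- The quartic under the square root decreases beyond its critical point `3M/2`. -/
lemma cube_mul_sub_antitoneOn (M : ℝ) :
    AntitoneOn (fun r : ℝ => r^3 * (2*M - r)) (Ici (3*M/2)) := by
  refine antitoneOn_of_deriv_nonpos (convex_Ici _) (by fun_prop) (fun x _ =>
    (hasDerivAt_cube_mul_sub M x).differentiableAt.differentiableWithinAt) fun x hx => ?_
  rw [interior_Ici, mem_Ioi] at hx
  rw [(hasDerivAt_cube_mul_sub M x).deriv]
  exact mul_nonpos_of_nonneg_of_nonpos (by positivity) (by linarith)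

lemma hasDerivAt_neg_mul_cube_add_sqrt {M H r : ℝ} (h0 : 0 < r) (h1 : r < 2*M) :
    HasDerivAt (fun r : ℝ => -H * r^3 + √(r^3 * (2*M - r)))
      (r^2 / √(r^3 * (2*M - r)) * (-3*H * √(r^3 * (2*M - r)) + (3*M - 2*r))) r := by
  have hpos : 0 < r^3 * (2*M - r) := mul_pos (by positivity) (by linarith)
  have hs := (Real.sqrt_pos.2 hpos).ne'
  refine (((hasDerivAt_pow 3 r).const_mul (-H)).add
    ((hasDerivAt_cube_mul_sub M r).sqrt hpos.ne')).congr_deriv ?_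
  generalize √(r^3 * (2*M - r)) = s at hs ⊢
  field_simp
  push_cast
  ring

/-- For `H ≤ 0`, the function `k̃_H(r) = -H r³ + r^{3/2}(2M - r)^{1/2}` on `[0, 2M]` is
unimodal: there is a unique `R_H ∈ (0, 2M)` with `k̃_H` strictly increasing on `[0, R_H]`
and strictly decreasing on `[R_H, 2M]`; moreover `R_H ∈ [3M/2, 2M)` with `R_H = 3M/2`
iff `H = 0`, and the maximum value `C_H = k̃_H(R_H)` satisfies `C_H > 0` and
`C_H > k̃_H(2M) = -8M³H`. -/
theorem stmt6 (M H : ℝ) (hM : 0 < M) (hH : H ≤ 0) (k : ℝ → ℝ)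
    (hk : ∀ r, k r = -H * r^3 + r ^ ((3:ℝ)/2) * Real.sqrt (2*M - r)) :
    ∃ R ∈ Set.Ioo (0:ℝ) (2*M),
      StrictMonoOn k (Set.Icc 0 R) ∧
      StrictAntiOn k (Set.Icc R (2*M)) ∧
      (∀ R' ∈ Set.Ioo (0:ℝ) (2*M),
        StrictMonoOn k (Set.Icc 0 R') → StrictAntiOn k (Set.Icc R' (2*M)) → R' = R) ∧
      3*M/2 ≤ R ∧ R < 2*M ∧ (R = 3*M/2 ↔ H = 0) ∧
      0 < k R ∧ k (2*M) = -8*M^3*H ∧ k (2*M) < k R := by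
  have hk' : ∀ r, 0 ≤ r → k r = -H * r^3 + √(r^3 * (2*M - r)) := fun r hr => by
    rw [hk, rpow_three_halves_mul_sqrt hr]
  have hderiv : ∀ r ∈ Ioo 0 (2*M), HasDerivAt k
      (r^2 / √(r^3 * (2*M - r)) * (-3*H * √(r^3 * (2*M - r)) + (3*M - 2*r))) r := by
    intro r hr
    refine (hasDerivAt_neg_mul_cube_add_sqrt hr.1 hr.2).congr_of_eventuallyEq ?_
    filter_upwards [lt_mem_nhds hr.1] with x hx using hk' x hx.le
  have hcont : ContinuousOn k (Icc 0 (2*M)) :=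
    ContinuousOn.congr (f := fun r : ℝ => -H * r^3 + √(r^3 * (2*M - r))) (by fun_prop)
      fun r hr => hk' r hr.1
  have hfac : ∀ r ∈ Ioo 0 (2*M), 0 < √(r^3 * (2*M - r)) := fun r hr =>
    Real.sqrt_pos.2 (mul_pos (pow_pos hr.1 3) (sub_pos.2 hr.2))
  obtain ⟨φ, hφ⟩ : ∃ φ : ℝ → ℝ, ∀ r, φ r = -3*H * √(r^3 * (2*M - r)) + (3*M - 2*r) :=
    ⟨_, fun _ => rfl⟩
  have hφcont : Continuous φ := by
    rw [funext hφ]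
    fun_prop
  have hφleft : ∀ r, r < 3*M/2 → 0 < φ r := fun r hr => by
    rw [hφ]
    have : 0 ≤ -3*H * √(r^3 * (2*M - r)) := mul_nonneg (by linarith) (Real.sqrt_nonneg _)
    linarith
  have hφanti : StrictAntiOn φ (Ici (3*M/2)) := fun a ha b hb hab => by
    have := mul_le_mul_of_nonneg_left
      (Real.sqrt_le_sqrt (cube_mul_sub_antitoneOn M ha hb hab.le))
      (show 0 ≤ -3*H by linarith)
    simp only [hφ]
    linarith
  have hφend : φ (2*M) = -M := by simp [hφ]; ring
  have hφmid : 0 ≤ φ (3*M/2) := by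
    rw [hφ]
    have : 0 ≤ -3*H * √((3*M/2)^3 * (2*M - 3*M/2)) :=
      mul_nonneg (by linarith) (Real.sqrt_nonneg _)
    linarith
  obtain ⟨R, ⟨hR1, hR2⟩, hR⟩ : (0:ℝ) ∈ φ '' Icc (3*M/2) (2*M) :=
    intermediate_value_Icc' (by linarith) hφcont.continuousOn ⟨by linarith, hφmid⟩
  have hR0 : 0 < R := by linarith
  have hR2 : R < 2*M := hR2.lt_of_ne (by rintro rfl; linarith)
  have hmono : StrictMonoOn k (Icc 0 R) := by
    refine strictMonoOn_of_deriv_pos (convex_Icc _ _)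
      (hcont.mono (Icc_subset_Icc_right hR2.le)) fun x hx => ?_
    rw [interior_Icc] at hx
    have hx' : x ∈ Ioo 0 (2*M) := ⟨hx.1, hx.2.trans hR2⟩
    rw [(hderiv x hx').deriv, ← hφ]
    refine mul_pos (div_pos (pow_pos hx.1 2) (hfac x hx')) ?_
    rcases lt_or_ge x (3*M/2) with h | h
    · exact hφleft x h
    · exact hR ▸ hφanti h hR1 hx.2
  have hanti : StrictAntiOn k (Icc R (2*M)) := by
    refine strictAntiOn_of_deriv_neg (convex_Icc _ _)
      (hcont.mono (Icc_subset_Icc_left hR0.le)) fun x hx => ?_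
    rw [interior_Icc] at hx
    have hx' : x ∈ Ioo 0 (2*M) := ⟨hR0.trans hx.1, hx.2⟩
    rw [(hderiv x hx').deriv, ← hφ]
    refine mul_neg_of_pos_of_neg (div_pos (pow_pos hx'.1 2) (hfac x hx')) ?_
    exact hR ▸ hφanti hR1 (hR1.trans hx.1.le) hx.1
  have hkend : k (2*M) = -8*M^3*H := by
    rw [hk, sub_self, Real.sqrt_zero]
    ring
  have hlt : k (2*M) < k R := hanti ⟨le_rfl, hR2.le⟩ ⟨hR2.le, le_rfl⟩ hR2
  have hend_nonneg : 0 ≤ k (2*M) := by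
    rw [hkend]
    nlinarith [mul_nonneg (pow_pos hM 3).le (neg_nonneg.2 hH)]
  refine ⟨R, ⟨hR0, hR2⟩, hmono, hanti, fun R' hR' hm ha => ?_, hR1, hR2, ⟨fun h => ?_, fun h => ?_⟩,
    hend_nonneg.trans_lt hlt, hkend, hlt⟩
  · rcases lt_trichotomy R' R with h | h | h
    · exact absurd (hmono ⟨hR'.1.le, h.le⟩ ⟨hR0.le, le_rfl⟩ h)
        (ha ⟨le_rfl, hR'.2.le⟩ ⟨h.le, hR2.le⟩ h).not_gt
    · exact h
    · exact absurd (hm ⟨hR0.le, h.le⟩ ⟨hR'.1.le, le_rfl⟩ h)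
        (hanti ⟨le_rfl, hR2.le⟩ ⟨h.le, hR'.2.le⟩ h).not_gt
  · rw [hφ] at hR
    have : -3*H * √(R^3 * (2*M - R)) = 0 := by linarith
    have := (mul_eq_zero.1 this).resolve_right (hfac R ⟨hR0, hR2⟩).ne'
    linarith
  · rw [hφ, h] at hR
    linarith
end

section
/- Let M > 0. Define φ(r) := (2r − 3M)/(r^{3/2}(2M − r)^{1/2}) for r ∈ (3M/2, 2M). Then φ is strictly increasing on (3M/2, 2M), φ(r) → 0 as r → (3M/2)⁺, and φ(r) → +∞ as r → (2M)⁻. Consequently, for each H < 0 the equation φ(r) = −3H has a unique solution in (3M/2, 2M), and this solution is the unique critical point in (0, 2M) of r ↦ k̃(H,r) := −H r³ + r^{3/2}(2M − r)^{1/2}. -/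
open Real Filter Set

theorem rpow_three_halves {r : ℝ} (hr : 0 ≤ r) : r ^ ((3:ℝ)/2) = r * Real.sqrt r := by
  rw [show ((3:ℝ)/2) = 1 + 1/2 by norm_num, Real.rpow_add_of_nonneg hr (by norm_num) (by norm_num),
    Real.rpow_one, ← Real.sqrt_eq_rpow]

theorem strictMonoOn_sub_div_rpow {M : ℝ} (hM : 0 < M) :
    StrictMonoOn (fun r : ℝ => (2*r - 3*M) / (r ^ ((3:ℝ)/2) * Real.sqrt (2*M - r)))
      (Set.Ioo (3*M/2) (2*M)) := by
  rintro x ⟨hx1, hx2⟩ y ⟨hy1, hy2⟩ hxy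
  have hx0 : 0 < x := by linarith
  have hy0 : 0 < y := by linarith
  simp only [rpow_three_halves hx0.le, rpow_three_halves hy0.le, ← div_div]
  have hp := Real.sqrt_pos.2 hx0
  have hq := Real.sqrt_pos.2 hy0
  have hpq := Real.sqrt_lt_sqrt hx0.le hxy
  have hb := Real.sqrt_pos.2 (show 0 < 2*M - y by linarith)
  have hab : Real.sqrt (2*M - y) < Real.sqrt (2*M - x) :=
    Real.sqrt_lt_sqrt (by linarith) (by linarith)
  have key : (2*x - 3*M) / x / √x < (2*y - 3*M) / y / √y := by
    rw [div_div, div_div, div_lt_div_iff₀ (by positivity) (by positivity)]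
    have hxs := Real.sq_sqrt hx0.le
    have hys := Real.sq_sqrt hy0.le
    generalize √x = p at *
    generalize √y = q at *
    subst hxs hys
    have h1 : 0 < 3*M*(q^2 + q*p + p^2) - 2*p^2*q^2 := by
      have : 0 < p^2 * (2*M - q^2) := by apply mul_pos <;> linarith
      have h2 : 0 < M * (q*p) := by positivity
      nlinarith [mul_pos hM hy0, mul_pos hM hx0]
    nlinarith [mul_pos (sub_pos.2 hpq) h1]
  have hpos : 0 < (2*y - 3*M) / y / √y := by
    have : 0 < 2*y - 3*M := by linarith
    positivity
  exact div_lt_div₀ key hab.le hpos.le hb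

theorem continuousAt_sub_div_rpow {M r : ℝ} (h0 : 0 < r) (h1 : r < 2*M) :
    ContinuousAt (fun r : ℝ => (2*r - 3*M) / (r ^ ((3:ℝ)/2) * Real.sqrt (2*M - r))) r := by
  have h2 := Real.sqrt_pos.2 (sub_pos.2 h1)
  have h3 := Real.rpow_pos_of_pos h0 ((3:ℝ)/2)
  exact ContinuousAt.div (by fun_prop)
    ((Real.continuousAt_rpow_const _ _ (Or.inl h0.ne')).mul (by fun_prop)) (by positivity)

theorem tendsto_sub_div_rpow_atTop {M : ℝ} (hM : 0 < M) :
    Tendsto (fun r : ℝ => (2*r - 3*M) / (r ^ ((3:ℝ)/2) * Real.sqrt (2*M - r)))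
      (nhdsWithin (2*M) (Set.Iio (2*M))) atTop := by
  have hnum : Tendsto (fun r : ℝ => 2*r - 3*M) (nhdsWithin (2*M) (Set.Iio (2*M))) (nhds M) := by
    have : Continuous fun r : ℝ => 2*r - 3*M := by fun_prop
    convert (this.tendsto (2*M)).mono_left nhdsWithin_le_nhds using 2
    ring
  refine hnum.pos_mul_atTop hM (tendsto_inv_nhdsGT_zero.comp ?_)
  refine tendsto_nhdsWithin_iff.2 ⟨?_, ?_⟩
  · have : ContinuousAt (fun r : ℝ => r ^ ((3:ℝ)/2) * Real.sqrt (2*M - r)) (2*M) :=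
      (Real.continuousAt_rpow_const _ _ (Or.inl (by positivity))).mul (by fun_prop)
    convert this.tendsto.mono_left nhdsWithin_le_nhds using 2
    simp
  · filter_upwards [Ioo_mem_nhdsLT (show 0 < 2*M by positivity)] with r hr
    have h2 := Real.sqrt_pos.2 (sub_pos.2 hr.2)
    have h3 := Real.rpow_pos_of_pos hr.1 ((3:ℝ)/2)
    exact mul_pos h3 h2

theorem deriv_eq_zero_iff_sub_div_rpow {M H s : ℝ} (h0 : 0 < s) (h1 : s < 2*M) :
    deriv (fun u => -H * u^3 + u ^ ((3:ℝ)/2) * Real.sqrt (2*M - u)) s = 0 ↔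
      (2*s - 3*M) / (s ^ ((3:ℝ)/2) * Real.sqrt (2*M - s)) = -3*H := by
  have hms : 0 < 2*M - s := sub_pos.2 h1
  have hd : HasDerivAt (fun u => -H * u^3 + u ^ ((3:ℝ)/2) * Real.sqrt (2*M - u))
      (-H * (3 * s^2) + ((3/2 * s ^ ((3:ℝ)/2 - 1)) * √(2*M - s)
        + s ^ ((3:ℝ)/2) * (-1 / (2 * √(2*M - s))))) s := by
    have hc := (hasDerivAt_pow 3 s).const_mul (-H)
    have hr := Real.hasDerivAt_rpow_const (x := s) (p := (3:ℝ)/2) (Or.inl h0.ne')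
    have hq := ((hasDerivAt_id s).const_sub (2*M)).sqrt hms.ne'
    exact (hc.add (hr.mul hq)).congr_deriv (by simp)
  rw [hd.deriv, rpow_three_halves h0.le, show (3:ℝ)/2 - 1 = 1/2 by norm_num,
    ← Real.sqrt_eq_rpow]
  have ha := Real.sqrt_pos.2 h0
  have hb := Real.sqrt_pos.2 hms
  have has := Real.sq_sqrt h0.le
  have hbs := Real.sq_sqrt hms.le
  generalize √s = a at *
  generalize √(2*M - s) = b at *
  have hM : M = (b^2 + s) / 2 := by linarith
  subst hM
  subst has
  rw [div_eq_iff (by positivity)]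
  have e : -H * (3 * (a^2)^2) + (3/2 * a * b + a^2 * a * (-1 / (2 * b))) =
      -(a / b) * ((2*a^2 - 3*((b^2 + a^2)/2)) - -3*H*(a^2 * a * b)) := by
    field_simp
    ring
  rw [e, mul_eq_zero, sub_eq_zero]
  have : -(a / b) ≠ 0 := neg_ne_zero.2 (by positivity)
  simp only [this, false_or]

/-- The function `φ(r) = (2r - 3M)/(r^{3/2}√(2M - r))` is strictly increasing on
`(3M/2, 2M)`, tends to `0` at `(3M/2)⁺` and to `+∞` at `(2M)⁻`; hence for each `H < 0`
the equation `φ(r) = -3H` has a unique solution in `(3M/2, 2M)`, which is the unique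
critical point of `k̃(H,·)` in `(0, 2M)`. -/
theorem stmt7 (M : ℝ) (hM : 0 < M) (φ : ℝ → ℝ)
    (hφ : ∀ r, φ r = (2*r - 3*M) / (r ^ ((3:ℝ)/2) * Real.sqrt (2*M - r))) :
    StrictMonoOn φ (Set.Ioo (3*M/2) (2*M)) ∧
    Tendsto φ (nhdsWithin (3*M/2) (Set.Ioi (3*M/2))) (nhds 0) ∧
    Tendsto φ (nhdsWithin (2*M) (Set.Iio (2*M))) atTop ∧
    ∀ H < (0:ℝ), ∃ r,
      (r ∈ Set.Ioo (3*M/2) (2*M) ∧ φ r = -3*H) ∧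
      (∀ r', r' ∈ Set.Ioo (3*M/2) (2*M) ∧ φ r' = -3*H → r' = r) ∧
      (∀ s ∈ Set.Ioo (0:ℝ) (2*M),
        deriv (fun u => -H * u^3 + u ^ ((3:ℝ)/2) * Real.sqrt (2*M - u)) s = 0 ↔ s = r) := by
  obtain rfl : φ = fun r => (2*r - 3*M) / (r ^ ((3:ℝ)/2) * Real.sqrt (2*M - r)) := funext hφ
  have hmono := strictMonoOn_sub_div_rpow hM
  have htop := tendsto_sub_div_rpow_atTop hM
  have hlt : 3*M/2 < 2*M := by linarith
  have hzero : Tendsto (fun r : ℝ => (2*r - 3*M) / (r ^ ((3:ℝ)/2) * Real.sqrt (2*M - r)))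
      (nhdsWithin (3*M/2) (Set.Ioi (3*M/2))) (nhds 0) := by
    have := (continuousAt_sub_div_rpow (show 0 < 3*M/2 by positivity) hlt).tendsto
    convert this.mono_left nhdsWithin_le_nhds using 2
    rw [show 2*(3*M/2) - 3*M = 0 by ring, zero_div]
  refine ⟨hmono, hzero, htop, fun H hH => ?_⟩
  have hcont : ContinuousOn
      (fun r : ℝ => (2*r - 3*M) / (r ^ ((3:ℝ)/2) * Real.sqrt (2*M - r)))
      (Set.Ioo (3*M/2) (2*M)) := fun r hr =>
    (continuousAt_sub_div_rpow (by linarith [hr.1]) hr.2).continuousWithinAt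
  obtain ⟨r, hr, hrH⟩ := isPreconnected_Ioo.intermediate_value_Ioi
    (le_principal_iff.2 (Ioo_mem_nhdsGT hlt)) (le_principal_iff.2 (Ioo_mem_nhdsLT hlt))
    hcont hzero htop (show -3*H ∈ Set.Ioi (0:ℝ) from by simp only [Set.mem_Ioi]; linarith)
  have huniq : ∀ r', r' ∈ Set.Ioo (3*M/2) (2*M) ∧
      (2*r' - 3*M) / (r' ^ ((3:ℝ)/2) * Real.sqrt (2*M - r')) = -3*H → r' = r :=
    fun r' h => hmono.injOn h.1 hr (h.2.trans hrH.symm)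
  refine ⟨r, ⟨hr, hrH⟩, huniq, fun s hs => ?_⟩
  rw [deriv_eq_zero_iff_sub_div_rpow hs.1 hs.2]
  refine ⟨fun h => huniq s ⟨⟨?_, hs.2⟩, h⟩, ?_⟩
  · by_contra! hle
    have hden := mul_nonneg (Real.rpow_nonneg hs.1.le ((3:ℝ)/2)) (Real.sqrt_nonneg (2*M - s))
    have := div_nonpos_of_nonpos_of_nonneg (show 2*s - 3*M ≤ 0 by linarith) hden
    linarith
  · rintro rfl
    exact hrH
end

section
/- Let M > 0. For H ≤ 0 let R_H ∈ (0, 2M) be the unique maximizer of r ↦ k̃(H,r) := −H r³ + r^{3/2}(2M − r)^{1/2} on [0, 2M] and let C_H := k̃(H, R_H). Then both H ↦ R_H and H ↦ C_H are strictly decreasing on (−∞, 0]; that is, for H₁ < H₂ ≤ 0 one has R_{H₁} > R_{H₂} and C_{H₁} > C_{H₂}. -/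
open Real Filter Set

/-- If `f` and `f + c * r ^ 3` are both locally maximal at the same point `R ≠ 0` where `f` is
differentiable, then `c = 0`. -/
theorem eq_zero_of_isLocalMax_add_mul_cube {f : ℝ → ℝ} {c R : ℝ} (hR : R ≠ 0)
    (hf : DifferentiableAt ℝ f R) (h : IsLocalMax f R)
    (h' : IsLocalMax (fun r => f r + c * r ^ 3) R) : c = 0 := by
  have hd : HasDerivAt (fun r => f r + c * r ^ 3) (deriv f R + c * (3 * R ^ 2)) R := by
    simpa using hf.hasDerivAt.fun_add ((hasDerivAt_pow 3 R).const_mul c)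
  have h0 := h'.hasDerivAt_eq_zero hd
  rw [h.deriv_eq_zero, zero_add] at h0
  exact (mul_eq_zero.mp h0).resolve_right (by positivity)

theorem isLocalMax_of_forall_Icc_ne_lt {f : ℝ → ℝ} {a b R : ℝ} (hR : R ∈ Set.Ioo a b)
    (h : ∀ r ∈ Set.Icc a b, r ≠ R → f r < f R) : IsLocalMax f R := by
  filter_upwards [Icc_mem_nhds hR.1 hR.2] with r hr
  rcases eq_or_ne r R with rfl | hne
  · exact le_rfl
  · exact (h r hr hne).le

/-- Both the maximizer `R_H` and the maximum value `C_H = k̃(H, R_H)` of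
`k̃(H,·)` on `[0, 2M]` are strictly decreasing in `H` on `(-∞, 0]`. -/
theorem stmt8 (M : ℝ) (hM : 0 < M) (k : ℝ → ℝ → ℝ)
    (hk : ∀ H r, k H r = -H * r^3 + r ^ ((3:ℝ)/2) * Real.sqrt (2*M - r))
    (H₁ H₂ R₁ R₂ : ℝ) (h12 : H₁ < H₂) (h2 : H₂ ≤ 0)
    (hR₁ : R₁ ∈ Set.Ioo (0:ℝ) (2*M)) (hR₂ : R₂ ∈ Set.Ioo (0:ℝ) (2*M))
    (hmax₁ : ∀ r ∈ Set.Icc (0:ℝ) (2*M), r ≠ R₁ → k H₁ r < k H₁ R₁)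
    (hmax₂ : ∀ r ∈ Set.Icc (0:ℝ) (2*M), r ≠ R₂ → k H₂ r < k H₂ R₂) :
    R₂ < R₁ ∧ k H₂ R₂ < k H₁ R₁ := by
  have hshift : ∀ r, k H₁ r = k H₂ r + (H₂ - H₁) * r ^ 3 := fun r => by
    rw [hk, hk]; ring
  have hne : R₁ ≠ R₂ := by
    rintro rfl
    have hdiff : DifferentiableAt ℝ (k H₂) R₁ := by
      have hsub : 2 * M - R₁ ≠ 0 := (sub_pos.mpr hR₁.2).ne'
      rw [show k H₂ = fun r => -H₂ * r ^ 3 + r ^ ((3 : ℝ) / 2) * Real.sqrt (2 * M - r) from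
        funext (hk H₂)]
      refine DifferentiableAt.add (by fun_prop) (DifferentiableAt.mul ?_ ?_)
      · exact (Real.hasDerivAt_rpow_const (Or.inl hR₁.1.ne')).differentiableAt
      · exact DifferentiableAt.sqrt (by fun_prop) hsub
    have hmax := isLocalMax_of_forall_Icc_ne_lt hR₁ hmax₁
    rw [show k H₁ = fun r => k H₂ r + (H₂ - H₁) * r ^ 3 from funext hshift] at hmax
    exact (sub_pos.mpr h12).ne' (eq_zero_of_isLocalMax_add_mul_cube hR₁.1.ne' hdiff
      (isLocalMax_of_forall_Icc_ne_lt hR₂ hmax₂) hmax)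
  have hlt₁ := hmax₁ R₂ (Set.Ioo_subset_Icc_self hR₂) hne.symm
  have hlt₂ := hmax₂ R₁ (Set.Ioo_subset_Icc_self hR₁) hne
  rw [hshift, hshift] at hlt₁
  have hcube : R₂ ^ 3 < R₁ ^ 3 :=
    lt_of_mul_lt_mul_left (by linarith) (sub_pos.mpr h12).le
  have hpos : 0 < (H₂ - H₁) * R₂ ^ 3 := mul_pos (sub_pos.mpr h12) (pow_pos hR₂.1 3)
  refine ⟨lt_of_pow_lt_pow_left₀ 3 hR₁.1.le hcube, ?_⟩
  rw [hshift]
  linarith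
end

section
/- Let M > 0, H, c ∈ ℝ, and let I ⊆ (0, 2M) be an open interval on which l(r) := (Hr + c/r²)·√(r/(2M − r)) > 1. Set h(r) := 1 − 2M/r and suppose f : I → ℝ is differentiable with f'(r) = l(r)/(−h(r)·√(l(r)² − 1)) for all r ∈ I. Then for all r ∈ I the spacelike condition 1/h(r) − (f'(r))² h(r) > 0 holds, f' is differentiable, and f''(r) + ((1/h(r) − (f'(r))² h(r))·(2h(r)/r + h'(r)/2) + h'(r)/h(r))·f'(r) + 3H·(1/h(r) − (f'(r))² h(r))^{3/2} = 0, where h'(r) = 2M/r². -/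
open Real Filter Set

/-- The `f' > 0` branch of the explicit SS-CMC solution in the Schwarzschild interior
satisfies the spacelike condition and the SS-CMC equation (plus sign). -/
theorem stmt11 (M H c : ℝ) (hM : 0 < M) (a b : ℝ)
    (hab : Set.Ioo a b ⊆ Set.Ioo (0:ℝ) (2*M))
    (l h f : ℝ → ℝ)
    (hl : ∀ r, l r = (H*r + c/r^2) * Real.sqrt (r/(2*M - r)))
    (hh : ∀ r, h r = 1 - 2*M/r)
    (hl1 : ∀ r ∈ Set.Ioo a b, 1 < l r)
    (hf : ∀ r ∈ Set.Ioo a b,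
      HasDerivAt f (l r / (-(h r) * Real.sqrt ((l r)^2 - 1))) r) :
    ∀ r ∈ Set.Ioo a b,
      0 < 1/(h r) - (deriv f r)^2 * h r ∧
      DifferentiableAt ℝ (deriv f) r ∧
      deriv (deriv f) r
        + ((1/(h r) - (deriv f r)^2 * h r) * (2*(h r)/r + (2*M/r^2)/2)
            + (2*M/r^2)/(h r)) * deriv f r
        + 3*H * (1/(h r) - (deriv f r)^2 * h r) ^ ((3:ℝ)/2) = 0 := by
  intro r hr
  obtain ⟨hr0, hr2⟩ := hab hr
  have hMr : 0 < 2*M - r := by linarith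
  set q := Real.sqrt (r/(2*M - r)) with hq
  have hq0 : 0 < q := Real.sqrt_pos.mpr (div_pos hr0 hMr)
  have hq2 : q^2 = r/(2*M - r) := Real.sq_sqrt (div_pos hr0 hMr).le
  have hM' : 2*M = r*(1 + 1/q^2) := by rw [hq2]; field_simp; ring
  have hhq : h r = -(1/q^2) := by rw [hh, hM']; field_simp; ring
  set L := l r with hL
  have hLq : L = (H*r + c/r^2) * q := hl r
  have hL1 : 1 < L := hl1 r hr
  have hLs : 0 < L^2 - 1 := by nlinarith
  set s := Real.sqrt (L^2 - 1) with hs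
  have hs0 : 0 < s := Real.sqrt_pos.mpr hLs
  have hs2 : s^2 = L^2 - 1 := Real.sq_sqrt hLs.le
  have hfr : deriv f r = q^2 * L / s := by
    rw [(hf r hr).deriv, ← hL, ← hs, hhq]; field_simp
  have hW : 1/(h r) - (deriv f r)^2 * h r = (q/s)^2 := by
    rw [hfr, hhq]; field_simp; rw [hs2]; ring
  have hc : c = r^2 * (L/q - H*r) := by rw [hLq]; field_simp; ring
  have dq : HasDerivAt (fun x => Real.sqrt (x/(2*M - x)))
      ((1 * (2*M - r) - r * (-1)) / (2*M - r)^2 / (2 * q)) r :=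
    ((hasDerivAt_id' r).div ((hasDerivAt_id' r).const_sub (2*M)) hMr.ne').sqrt
      (div_pos hr0 hMr).ne'
  have hMr' : 2*M - r = r/q^2 := by rw [hM']; field_simp; ring
  have dA : HasDerivAt (fun x => H*x + c/x^2) (H - 2*c/r^3) r := by
    refine (((hasDerivAt_id' r).const_mul H).add
      ((hasDerivAt_const r c).div (hasDerivAt_pow 2 r) (pow_ne_zero 2 hr0.ne'))).congr_deriv ?_
    simp only [Nat.cast_ofNat, Nat.add_one_sub_one, pow_one]
    field_simp
    ring
  have dl : HasDerivAt l (3*H*q - 2*L/r + L*(q^2 + 1)/(2*r)) r := by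
    rw [show l = _ from funext hl]
    refine (dA.mul dq).congr_deriv ?_
    rw [← hq, hMr', show 1 * (r/q^2) - r * (-1) = r/q^2 + r by ring, hc]
    field_simp
    ring
  have dh : HasDerivAt h (2*M/r^2) r := by
    rw [show h = _ from funext hh]
    refine (((hasDerivAt_const r (2*M)).div (hasDerivAt_id' r) hr0.ne').const_sub 1).congr_deriv ?_
    ring
  have ds := ((dl.pow 2).sub_const 1).sqrt hLs.ne'
  have hne : -(h r) * Real.sqrt ((l r)^2 - 1) ≠ 0 := by
    rw [hhq, neg_neg]; exact (mul_pos (by positivity) hs0).ne'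
  have dF := dl.div (dh.neg.mul ds) hne
  have hev : deriv f =ᶠ[nhds r] fun x => l x / (-(h x) * Real.sqrt ((l x)^2 - 1)) := by
    filter_upwards [Ioo_mem_nhds hr.1 hr.2] with x hx using (hf x hx).deriv
  have dff := dF.congr_of_eventuallyEq hev
  refine ⟨hW ▸ by positivity, dff.differentiableAt, ?_⟩
  have hpow : ((q/s)^2) ^ ((3:ℝ)/2) = (q/s)^3 := by
    rw [← Real.rpow_natCast (q/s) 2, ← Real.rpow_mul (by positivity), ← Real.rpow_natCast]
    norm_num
  rw [hW, hpow, hfr, dff.deriv]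
  simp only [Pi.neg_apply, Pi.mul_apply, Pi.pow_apply, ← hL, ← hs, hhq]
  rw [hM']
  field_simp
  simp only [hs2]
  ring
end

section
/- Let M > 0, H, c ∈ ℝ, and let I ⊆ (0, 2M) be an open interval on which l(r) := (Hr + c/r²)·√(r/(2M − r)) > 1. Set h(r) := 1 − 2M/r and suppose f : I → ℝ is differentiable with f'(r) = l(r)/(h(r)·√(l(r)² − 1)) for all r ∈ I. Then for all r ∈ I the spacelike condition 1/h(r) − (f'(r))² h(r) > 0 holds, f' is differentiable, and f''(r) + ((1/h(r) − (f'(r))² h(r))·(2h(r)/r + h'(r)/2) + h'(r)/h(r))·f'(r) − 3H·(1/h(r) − (f'(r))² h(r))^{3/2} = 0, where h'(r) = 2M/r². -/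
open Real Filter Set

/-- The derivative of `q = √(r / (2M - r)) = 1 / √(-h)` is `q³ h' / 2`. -/
lemma hasDerivAt_sqrt_div_two_mul_sub {M r : ℝ} (hr : 0 < r) (hrM : r < 2 * M) :
    HasDerivAt (fun x => √(x / (2 * M - x)))
      (√(r / (2 * M - r)) ^ 3 * (2 * M / r ^ 2) / 2) r := by
  have hD : 0 < 2 * M - r := by linarith
  have hpos : 0 < r / (2 * M - r) := div_pos hr hD
  have hq := Real.sqrt_pos.2 hpos
  have hq2 := Real.sq_sqrt hpos.le
  have key := (((hasDerivAt_id r).div ((hasDerivAt_id r).const_sub (2 * M)) hD.ne').sqrt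
    hpos.ne')
  refine key.congr_deriv ?_
  simp only [id, Pi.div_apply]
  set q := √(r / (2 * M - r)) with hqdef
  have h4 : q ^ 4 = (r / (2 * M - r)) ^ 2 := by rw [← hq2]; ring
  rw [div_eq_iff (by positivity)]
  calc _ = (r / (2 * M - r)) ^ 2 * (2 * M / r ^ 2) := by field_simp; ring
    _ = _ := by rw [← h4]; ring

/-- With `h = -1 / q²` and `s² = l² - 1`, the quantity `1 / h - (f')² h` equals `(q / s)²`
for `f' = l / (h s)`. -/
lemma one_div_sub_sq_mul_eq_div_sq {l q s : ℝ} (hq : q ≠ 0) (hs : s ≠ 0)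
    (hs2 : s ^ 2 = l ^ 2 - 1) :
    1 / (-1 / q ^ 2) - (l / (-1 / q ^ 2 * s)) ^ 2 * (-1 / q ^ 2) = (q / s) ^ 2 := by
  have : l ^ 2 = s ^ 2 + 1 := by linarith
  field_simp
  linear_combination this

/-- The `f' < 0` branch of the explicit SS-CMC solution in the Schwarzschild interior
satisfies the spacelike condition and the SS-CMC equation (minus sign). -/
theorem stmt12 (M H c : ℝ) (hM : 0 < M) (a b : ℝ)
    (hab : Set.Ioo a b ⊆ Set.Ioo (0:ℝ) (2*M))
    (l h f : ℝ → ℝ)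
    (hl : ∀ r, l r = (H*r + c/r^2) * Real.sqrt (r/(2*M - r)))
    (hh : ∀ r, h r = 1 - 2*M/r)
    (hl1 : ∀ r ∈ Set.Ioo a b, 1 < l r)
    (hf : ∀ r ∈ Set.Ioo a b,
      HasDerivAt f (l r / (h r * Real.sqrt ((l r)^2 - 1))) r) :
    ∀ r ∈ Set.Ioo a b,
      0 < 1/(h r) - (deriv f r)^2 * h r ∧
      DifferentiableAt ℝ (deriv f) r ∧
      deriv (deriv f) r
        + ((1/(h r) - (deriv f r)^2 * h r) * (2*(h r)/r + (2*M/r^2)/2)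
            + (2*M/r^2)/(h r)) * deriv f r
        - 3*H * (1/(h r) - (deriv f r)^2 * h r) ^ ((3:ℝ)/2) = 0 := by
  intro r hr
  obtain ⟨hr0, hrM⟩ := hab hr
  have hD : 0 < 2 * M - r := by linarith
  have hpos : 0 < r / (2 * M - r) := div_pos hr0 hD
  have hl1r := hl1 r hr
  have hdq := hasDerivAt_sqrt_div_two_mul_sub hr0 hrM
  have hs2pos : 0 < l r ^ 2 - 1 := by nlinarith
  have hq := Real.sqrt_pos.2 hpos
  have hq2 := Real.sq_sqrt hpos.le
  have hs := Real.sqrt_pos.2 hs2pos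
  have hs2 := Real.sq_sqrt hs2pos.le
  have hhr : h r = -1 / √(r / (2 * M - r)) ^ 2 := by
    rw [hh, hq2]; field_simp; ring
  have hdh : HasDerivAt h (2 * M / r ^ 2) r := by
    rw [funext hh]
    refine (((hasDerivAt_inv hr0.ne').const_mul (2 * M)).const_sub 1).congr_deriv ?_
    field_simp
  have hdl : HasDerivAt l ((H - 2 * c / r ^ 3) * √(r / (2 * M - r))
      + (H * r + c / r ^ 2) * (√(r / (2 * M - r)) ^ 3 * (2 * M / r ^ 2) / 2)) r := by
    rw [funext hl]
    have hpoly : HasDerivAt (fun x => H * x + c / x ^ 2) (H - 2 * c / r ^ 3) r := by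
      refine (((hasDerivAt_id r).const_mul H).add ((hasDerivAt_const r c).div
        (hasDerivAt_pow 2 r) (by positivity))).congr_deriv ?_
      field_simp
      ring
    exact hpoly.mul hdq
  have hlr := hl r
  have hds := ((hdl.pow 2).sub_const 1).sqrt hs2pos.ne'
  have hhs : h r * √(l r ^ 2 - 1) ≠ 0 := by
    refine mul_ne_zero ?_ hs.ne'
    rw [hhr]
    exact (div_neg_of_neg_of_pos (by norm_num) (by positivity)).ne
  have hd2 := (hdl.div (hdh.mul hds) hhs).congr_of_eventuallyEq (f₁ := deriv f) (by
    filter_upwards [isOpen_Ioo.mem_nhds hr] with x hx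
    exact (hf x hx).deriv)
  refine ⟨?_, hd2.differentiableAt, ?_⟩
  · rw [(hf r hr).deriv, hhr, one_div_sub_sq_mul_eq_div_sq hq.ne' hs.ne' hs2]
    positivity
  rw [hd2.deriv, (hf r hr).deriv]
  simp only [Pi.mul_apply, Pi.pow_apply]
  rw [hhr, one_div_sub_sq_mul_eq_div_sq hq.ne' hs.ne' hs2]
  generalize √(l r ^ 2 - 1) = s at *
  generalize √(r / (2 * M - r)) = q at *
  have hW : ((q / s) ^ 2) ^ ((3 : ℝ) / 2) = (q / s) ^ 3 := by
    rw [← Real.rpow_natCast, ← Real.rpow_mul (by positivity), ← Real.rpow_natCast]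
    norm_num
  rw [hW]
  generalize 2 * M / r ^ 2 = e at *
  have hrel : ((H - 2 * c / r ^ 3) * q + (H * r + c / r ^ 2) * (q ^ 3 * e / 2))
      = 3 * H * q - 2 * l r / r + l r * q ^ 2 * e / 2 := by
    rw [hlr]; field_simp; ring
  rw [hrel]
  generalize l r = L at *
  have hL : L ^ 2 = s ^ 2 + 1 := by linarith
  field_simp
  push_cast
  linear_combination (2 * q ^ 2 * (2 * (3 * H * q * r - 2 * L) + q ^ 2 * L * r * e)) * hL
end

section
/- Let M > 0, p > 1, C > 0, and define y(r) := r^{3/2}(2M − r)^{1/2} + (C/(p+2))(r^{1−p} − r³/(2M)^{p+2}) on (0, 2M]. Then for every H ≤ 0 there is exactly one r ∈ (0, 2M] with y(r) = −H r³ + r^{3/2}(2M − r)^{1/2}; for H < 0 this solution lies in (0, 2M), and for H = 0 it is r = 2M. -/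
open Real Filter Set

/-- The difference of the two curves factors through `r ^ (-(p + 2))`, so the intersection
equation has an explicit solution. -/
theorem intersection_iff {L p C H r : ℝ} (hL : 0 < L) (hp : 1 < p) (hC : 0 < C) (hH : H ≤ 0)
    (hr : 0 < r) (s : ℝ) :
    s + (C / (p + 2)) * (r ^ (1 - p) - r ^ 3 / L ^ (p + 2)) = -H * r ^ 3 + s ↔
      r = (L ^ (-(p + 2)) - H * (p + 2) / C) ^ (-(p + 2))⁻¹ := by
  have hq : 0 < p + 2 := by linarith
  have hA : 0 ≤ L ^ (-(p + 2)) - H * (p + 2) / C := by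
    have h₁ : 0 < L ^ (-(p + 2)) := rpow_pos_of_pos hL _
    have h₂ : H * (p + 2) / C ≤ 0 :=
      div_nonpos_of_nonpos_of_nonneg (mul_nonpos_of_nonpos_of_nonneg hH hq.le) hC.le
    linarith
  have hpow : r ^ (1 - p) = r ^ 3 * r ^ (-(p + 2)) := by
    rw [← rpow_natCast, ← rpow_add hr]
    congr 1
    push_cast
    ring
  rw [Real.eq_rpow_inv hr.le hA (by linarith), hpow, div_eq_mul_inv (r ^ 3), ← rpow_neg hL.le]
  generalize r ^ (-(p + 2)) = u
  generalize L ^ (-(p + 2)) = v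
  have hfactor : s + C / (p + 2) * (r ^ 3 * u - r ^ 3 * v) - (-H * r ^ 3 + s) =
      C / (p + 2) * r ^ 3 * (u - (v - H * (p + 2) / C)) := by
    field_simp
    ring
  have hne : C / (p + 2) * r ^ 3 ≠ 0 := by positivity
  rw [← sub_eq_zero, hfactor, mul_eq_zero, or_iff_right hne, sub_eq_zero]

/-- The curve `γ` given by the explicit function `y` intersects each curve
`k̃(H,·)`, `H ≤ 0`, exactly once on `(0, 2M]`; the intersection is interior for
`H < 0` and is at `r = 2M` for `H = 0`. -/
theorem stmt14 (M p C : ℝ) (hM : 0 < M) (hp : 1 < p) (hC : 0 < C)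
    (y : ℝ → ℝ)
    (hy : ∀ r, y r = r ^ ((3:ℝ)/2) * Real.sqrt (2*M - r)
        + (C/(p+2)) * (r ^ (1-p) - r^3 / (2*M) ^ (p+2))) :
    ∀ H ≤ (0:ℝ),
      (∃! r, r ∈ Set.Ioc (0:ℝ) (2*M) ∧
        y r = -H * r^3 + r ^ ((3:ℝ)/2) * Real.sqrt (2*M - r)) ∧
      (H < 0 → ∀ r ∈ Set.Ioc (0:ℝ) (2*M),
        y r = -H * r^3 + r ^ ((3:ℝ)/2) * Real.sqrt (2*M - r) → r < 2*M) ∧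
      (H = 0 → y (2*M) = -H * (2*M)^3 + (2*M) ^ ((3:ℝ)/2) * Real.sqrt (2*M - 2*M)) := by
  intro H hH
  have hL : 0 < 2 * M := by linarith
  have hq : 0 < p + 2 := by linarith
  have hneg : (-(p + 2))⁻¹ ≤ 0 := inv_nonpos.2 (by linarith)
  have hLpow : 0 < (2 * M) ^ (-(p + 2)) := rpow_pos_of_pos hL _
  have hLinv : ((2 * M) ^ (-(p + 2))) ^ (-(p + 2))⁻¹ = 2 * M :=
    rpow_rpow_inv hL.le (by linarith)
  have hterm : H * (p + 2) / C ≤ 0 :=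
    div_nonpos_of_nonpos_of_nonneg (mul_nonpos_of_nonpos_of_nonneg hH hq.le) hC.le
  have key : ∀ r, 0 < r →
      (y r = -H * r ^ 3 + r ^ ((3 : ℝ) / 2) * Real.sqrt (2 * M - r) ↔
        r = ((2 * M) ^ (-(p + 2)) - H * (p + 2) / C) ^ (-(p + 2))⁻¹) := by
    intro r hr
    rw [hy]
    exact intersection_iff hL hp hC hH hr _
  refine ⟨⟨((2 * M) ^ (-(p + 2)) - H * (p + 2) / C) ^ (-(p + 2))⁻¹, ?_, ?_⟩, ?_, ?_⟩
  · have hpos : 0 < ((2 * M) ^ (-(p + 2)) - H * (p + 2) / C) ^ (-(p + 2))⁻¹ :=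
      rpow_pos_of_pos (by linarith) _
    refine ⟨⟨hpos, ?_⟩, (key _ hpos).2 rfl⟩
    exact (rpow_le_rpow_of_nonpos hLpow (by linarith) hneg).trans_eq hLinv
  · rintro r ⟨hr, h⟩
    exact (key r hr.1).1 h
  · intro hH' r hr h
    rw [(key r hr.1).1 h]
    have hlt : H * (p + 2) / C < 0 := div_neg_of_neg_of_pos (mul_neg_of_neg_of_pos hH' hq) hC
    exact (rpow_lt_rpow_of_neg hLpow (by linarith) (inv_lt_zero.2 (by linarith))).trans_eq hLinv
  · intro hH'
    rw [key _ hL, hH', zero_mul, zero_div, sub_zero, hLinv]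
end

section
/- Let M > 0, p > 1, C > 0, and define y(r) := r^{3/2}(2M − r)^{1/2} + (C/(p+2))(r^{1−p} − r³/(2M)^{p+2}) on (0, 2M]. Define H(r) := (r^{3/2}(2M − r)^{1/2} − y(r))/r³ for r ∈ (0, 2M]. Then H(r) = −(C/(p+2))(r^{−(p+2)} − (2M)^{−(p+2)}), H is strictly increasing on (0, 2M], H(2M) = 0, and H(r) → −∞ as r → 0⁺. Moreover, for each r ∈ (0, 2M], H(r) is the unique real number H with y(r) = −H r³ + r^{3/2}(2M − r)^{1/2}. -/
open Real Filter Set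

/-- Along the curve `γ`, the mean curvature `H(r) = (r^{3/2}√(2M-r) - y(r))/r³` equals
`-(C/(p+2))(r^{-(p+2)} - (2M)^{-(p+2)})`, is strictly increasing on `(0, 2M]`, vanishes
at `2M`, tends to `-∞` at `0⁺`, and is the unique `H` with
`y(r) = -H r³ + r^{3/2}(2M-r)^{1/2}`. -/
theorem stmt15 (M p C : ℝ) (hM : 0 < M) (hp : 1 < p) (hC : 0 < C)
    (y Hf : ℝ → ℝ)
    (hy : ∀ r, y r = r ^ ((3:ℝ)/2) * Real.sqrt (2*M - r)
        + (C/(p+2)) * (r ^ (1-p) - r^3 / (2*M) ^ (p+2)))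
    (hHf : ∀ r, Hf r = (r ^ ((3:ℝ)/2) * Real.sqrt (2*M - r) - y r) / r^3) :
    (∀ r ∈ Set.Ioc (0:ℝ) (2*M),
      Hf r = -(C/(p+2)) * (r ^ (-(p+2)) - (2*M) ^ (-(p+2)))) ∧
    StrictMonoOn Hf (Set.Ioc 0 (2*M)) ∧
    Hf (2*M) = 0 ∧
    Tendsto Hf (nhdsWithin 0 (Set.Ioi 0)) atBot ∧
    (∀ r ∈ Set.Ioc (0:ℝ) (2*M), ∀ H : ℝ,
      y r = -H * r^3 + r ^ ((3:ℝ)/2) * Real.sqrt (2*M - r) ↔ H = Hf r) := by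
  have hk : 0 < C / (p + 2) := by positivity
  have hform : ∀ r, 0 < r → Hf r = -(C/(p+2)) * (r ^ (-(p+2)) - (2*M) ^ (-(p+2))) := by
    intro r hr
    have hpow : r ^ (1 - p) = r ^ (-(p + 2)) * r ^ 3 := by
      rw [← rpow_natCast r 3, ← rpow_add hr]
      congr 1
      push_cast
      ring
    rw [hHf, hy, hpow, rpow_neg (by positivity : (0:ℝ) ≤ 2 * M)]
    field_simp
    ring
  refine ⟨fun r hr => hform r hr.1, ?_, ?_, ?_, ?_⟩
  · intro a ha b hb hab
    rw [hform a ha.1, hform b hb.1]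
    have hlt : b ^ (-(p + 2)) < a ^ (-(p + 2)) := rpow_lt_rpow_of_neg ha.1 hab (by linarith)
    nlinarith
  · rw [hform _ (by positivity), sub_self, mul_zero]
  · have hlim : Tendsto (fun r : ℝ => -(C/(p+2)) * (r ^ (-(p+2)) - (2*M) ^ (-(p+2))))
        (nhdsWithin 0 (Set.Ioi 0)) atBot :=
      (tendsto_atTop_add_const_right _ (-(2*M) ^ (-(p+2)))
        (tendsto_rpow_neg_nhdsGT_zero (by linarith))).const_mul_atTop_of_neg (neg_lt_zero.mpr hk)
    exact hlim.congr' (eventually_mem_nhdsWithin.mono fun r hr => (hform r hr).symm)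
  · intro r hr H
    have hr3 : r ^ 3 ≠ 0 := pow_ne_zero 3 hr.1.ne'
    rw [hHf, eq_div_iff hr3]
    constructor <;> intro h <;> linarith
end
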